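/- Let P, Q be Borel probability measures on ℝ with finite second moments and assume P is atomless. Define T = F_Q⁻¹ ∘ F_P, where F_P(s) = P((−∞,s]) and F_Q⁻¹(u) = inf{ s ∈ ℝ : Q((−∞,s]) > u }. Then T is Borel measurable, the pushforward of P under T equals Q, and ∫ (s − T(s))² dP(s) equals the infimum of ∫ (s−t)² dπ(s,t) over all couplings π of P and Q. -/

import Mathlib

open MeasureTheory ENNReal

noncomputable section

/-- `π` is a coupling of `μ` and `ν`. -/
def IsCoupling {α β : Type*} [MeasurableSpace α] [MeasurableSpace β]
    (μ : Measure α) (ν : Measure β) (π : Measure (α × β)) : Prop :=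
  π.map Prod.fst = μ ∧ π.map Prod.snd = ν

/-- The right-continuous quantile function `F_Q⁻¹(u) = inf { s : Q((-∞,s]) > u }`. -/
def invF (Q : Measure ℝ) (u : ℝ) : ℝ := sInf {s : ℝ | u < (Q (Set.Iic s)).toReal}

lemma invF_of_neg (Q : Measure ℝ) {u : ℝ} (hu : u < 0) : invF Q u = 0 := by
  have : {s : ℝ | u < (Q (Set.Iic s)).toReal} = Set.univ :=
    Set.eq_univ_of_forall fun _ => hu.trans_le ENNReal.toReal_nonneg
  rw [invF, this, Real.sInf_univ]

section Quantile

variable (Q : Measure ℝ) [IsProbabilityMeasure Q]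

lemma bddBelow_setOf_lt_measure_Iic {u : ℝ} (hu : 0 < u) :
    BddBelow {s : ℝ | u < (Q (Set.Iic s)).toReal} := by
  obtain ⟨b, hb⟩ := ((ProbabilityTheory.tendsto_cdf_atBot Q).eventually_lt_const hu).exists
  rw [ProbabilityTheory.cdf_eq_real] at hb
  refine ⟨b, fun s (hs : u < Q.real (Set.Iic s)) => ?_⟩
  by_contra! h
  have := measureReal_mono (μ := Q) (Set.Iic_subset_Iic.2 h.le)
  linarith

lemma nonempty_setOf_lt_measure_Iic {u : ℝ} (hu : u < 1) :
    {s : ℝ | u < (Q (Set.Iic s)).toReal}.Nonempty := by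
  obtain ⟨b, hb⟩ := ((ProbabilityTheory.tendsto_cdf_atTop Q).eventually_const_lt hu).exists
  rw [ProbabilityTheory.cdf_eq_real] at hb
  exact ⟨b, hb⟩

lemma invF_monotoneOn : MonotoneOn (invF Q) (Set.Ioo 0 1) := fun _ hu _ hv huv =>
  csInf_le_csInf (bddBelow_setOf_lt_measure_Iic Q hu.1) (nonempty_setOf_lt_measure_Iic Q hv.2)
    fun _ hs => lt_of_le_of_lt huv hs

lemma invF_of_one_le {u : ℝ} (hu : 1 ≤ u) : invF Q u = 0 := by
  have : {s : ℝ | u < (Q (Set.Iic s)).toReal} = ∅ :=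
    Set.eq_empty_of_forall_notMem fun s (hs : u < Q.real (Set.Iic s)) =>
      (hs.trans_le measureReal_le_one).not_ge hu
  rw [invF, this, Real.sInf_empty]

lemma measurable_invF : Measurable (invF Q) := by
  refine measurable_of_restrict_of_restrict_compl (measurableSet_Ioo (a := (0 : ℝ)) (b := 1)) ?_ ?_
  · have : Monotone ((Set.Ioo (0 : ℝ) 1).domRestrict (invF Q)) := fun u v huv =>
      invF_monotoneOn Q u.2 v.2 huv
    exact this.measurable
  · have : (Set.Ioo (0 : ℝ) 1)ᶜ.domRestrict (invF Q) =
        (Set.Ioo (0 : ℝ) 1)ᶜ.domRestrict (fun u => if u = 0 then invF Q 0 else 0) := by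
      ext ⟨u, hu⟩
      simp only [Set.domRestrict_apply]
      split_ifs with h
      · rw [h]
      · rcases lt_or_gt_of_ne h with h | h
        · exact invF_of_neg Q h
        · exact invF_of_one_le Q (not_lt.1 fun h1 => hu ⟨h, h1⟩)
    rw [this]
    have hite : Measurable fun u : ℝ => if u = 0 then invF Q 0 else 0 :=
      Measurable.ite (measurableSet_eq_fun measurable_id measurable_const)
        measurable_const measurable_const
    exact hite.comp measurable_subtype_coe

lemma invF_le_of_lt {u t : ℝ} (hu : 0 < u) (h : u < Q.real (Set.Iic t)) : invF Q u ≤ t :=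
  csInf_le (bddBelow_setOf_lt_measure_Iic Q hu) h

lemma le_measure_Iic_of_invF_le {u t : ℝ} (hu : u < 1) (h : invF Q u ≤ t) :
    u ≤ Q.real (Set.Iic t) := by
  have hright : Filter.Tendsto (ProbabilityTheory.cdf Q) (nhdsWithin t (Set.Ioi t))
      (nhds (ProbabilityTheory.cdf Q t)) :=
    ((ProbabilityTheory.cdf Q).right_continuous t).mono Set.Ioi_subset_Ici_self
  rw [← ProbabilityTheory.cdf_eq_real]
  refine ge_of_tendsto hright ?_
  filter_upwards [self_mem_nhdsWithin] with r (hr : t < r)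
  obtain ⟨s, hs, hsr⟩ := exists_lt_of_csInf_lt (nonempty_setOf_lt_measure_Iic Q hu)
    (h.trans_lt hr)
  rw [ProbabilityTheory.cdf_eq_real]
  exact (show u < Q.real (Set.Iic s) from hs).le.trans
    (measureReal_mono (Set.Iic_subset_Iic.2 hsr.le))

end Quantile

section Atomless

variable (P : Measure ℝ) [IsProbabilityMeasure P]

lemma continuous_cdf_of_atomless (h : ∀ s : ℝ, P {s} = 0) :
    Continuous (ProbabilityTheory.cdf P) := by
  refine continuous_iff_continuousAt.2 fun s => ?_
  rw [(ProbabilityTheory.cdf P).mono.continuousAt_iff_leftLim_eq_rightLim,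
    (ProbabilityTheory.cdf P).rightLim_eq]
  have h1 := (ProbabilityTheory.cdf P).measure_singleton s
  rw [ProbabilityTheory.measure_cdf, h s, eq_comm, ENNReal.ofReal_eq_zero] at h1
  exact le_antisymm ((ProbabilityTheory.cdf P).mono.leftLim_le le_rfl) (by linarith)

lemma exists_cdf_eq (h : ∀ s : ℝ, P {s} = 0) {u : ℝ} (hu : u ∈ Set.Ioo (0 : ℝ) 1) :
    ∃ c, ProbabilityTheory.cdf P c = u := by
  obtain ⟨a, ha⟩ := ((ProbabilityTheory.tendsto_cdf_atBot P).eventually_lt_const hu.1).exists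
  obtain ⟨b, hb⟩ := ((ProbabilityTheory.tendsto_cdf_atTop P).eventually_const_lt hu.2).exists
  exact mem_range_of_exists_le_of_exists_ge (continuous_cdf_of_atomless P h) ⟨a, ha.le⟩ ⟨b, hb.le⟩

lemma measureReal_cdf_le_le (h : ∀ s : ℝ, P {s} = 0) {u : ℝ} (hu : 0 ≤ u) :
    P.real {s | ProbabilityTheory.cdf P s ≤ u} ≤ u := by
  refine le_of_forall_gt_imp_ge_of_dense fun v hv => ?_
  rcases le_or_gt 1 v with hv1 | hv1
  · exact measureReal_le_one.trans hv1
  obtain ⟨c, hc⟩ := exists_cdf_eq P h ⟨hu.trans_lt hv, hv1⟩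
  rw [← hc, ProbabilityTheory.cdf_eq_real]
  refine measureReal_mono fun s (hs : _ ≤ u) => ?_
  by_contra hsc
  have := (ProbabilityTheory.cdf P).mono (not_le.1 hsc).le
  linarith

lemma le_measureReal_cdf_lt (h : ∀ s : ℝ, P {s} = 0) {u : ℝ} (hu : u ≤ 1) :
    u ≤ P.real {s | ProbabilityTheory.cdf P s < u} := by
  refine le_of_forall_lt_imp_le_of_dense fun v hv => ?_
  rcases le_or_gt v 0 with hv0 | hv0
  · exact hv0.trans measureReal_nonneg
  obtain ⟨c, hc⟩ := exists_cdf_eq P h ⟨hv0, hv.trans_le hu⟩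
  conv_lhs => rw [← hc, ProbabilityTheory.cdf_eq_real]
  refine measureReal_mono fun s (hs : s ≤ c) => ?_
  exact ((ProbabilityTheory.cdf P).mono hs).trans_lt (hc.trans_lt hv)

lemma ae_cdf_mem_Ioo (h : ∀ s : ℝ, P {s} = 0) :
    ∀ᵐ s ∂P, ProbabilityTheory.cdf P s ∈ Set.Ioo (0 : ℝ) 1 := by
  have h0 : ∀ᵐ s ∂P, 0 < ProbabilityTheory.cdf P s := by
    have := le_antisymm (measureReal_cdf_le_le P h le_rfl) measureReal_nonneg
    rw [measureReal_eq_zero_iff] at this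
    simpa [ae_iff] using this
  have h1 : ∀ᵐ s ∂P, ProbabilityTheory.cdf P s < 1 := by
    have hm : MeasurableSet {s | ProbabilityTheory.cdf P s < 1} :=
      measurableSet_lt (ProbabilityTheory.cdf P).mono.measurable measurable_const
    refine (mem_ae_iff_prob_eq_one hm).2 (le_antisymm prob_le_one ?_)
    have := le_measureReal_cdf_lt P h le_rfl
    rwa [measureReal_def, ← ENNReal.toReal_one,
      ENNReal.toReal_le_toReal ENNReal.one_ne_top (measure_ne_top _ _)] at this
  filter_upwards [h0, h1] with s hs0 hs1 using ⟨hs0, hs1⟩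

end Atomless

section Rearrangement

variable (P Q : Measure ℝ) [IsProbabilityMeasure P] [IsProbabilityMeasure Q]

lemma measurable_invF_comp_cdf : Measurable fun s => invF Q ((P (Set.Iic s)).toReal) := by
  have : Monotone fun s => (P (Set.Iic s)).toReal := fun _ _ h =>
    measureReal_mono (Set.Iic_subset_Iic.2 h)
  exact (measurable_invF Q).comp this.measurable

lemma map_invF_comp_cdf (h : ∀ s : ℝ, P {s} = 0) :
    P.map (fun s => invF Q ((P (Set.Iic s)).toReal)) = Q := by
  have hT := measurable_invF_comp_cdf P Q
  have : IsProbabilityMeasure (P.map (fun s => invF Q ((P (Set.Iic s)).toReal))) :=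
    Measure.isProbabilityMeasure_map hT.aemeasurable
  refine Measure.ext_of_Iic _ _ fun t => ?_
  rw [← measureReal_eq_measureReal_iff, map_measureReal_apply hT measurableSet_Iic]
  have hae := ae_cdf_mem_Ioo P h
  simp only [ProbabilityTheory.cdf_eq_real] at hae
  have hle := measureReal_cdf_le_le P h (u := Q.real (Set.Iic t)) measureReal_nonneg
  have hge := le_measureReal_cdf_lt P h (u := Q.real (Set.Iic t)) measureReal_le_one
  simp only [ProbabilityTheory.cdf_eq_real] at hle hge
  refine le_antisymm (le_trans ?_ hle) (hge.trans ?_)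
  · refine ENNReal.toReal_mono (measure_ne_top _ _) (measure_mono_ae ?_)
    filter_upwards [hae] with s hs hst
    exact le_measure_Iic_of_invF_le Q hs.2 hst
  · refine ENNReal.toReal_mono (measure_ne_top _ _) (measure_mono_ae ?_)
    filter_upwards [hae] with s hs hst
    exact invF_le_of_lt Q hs.1 hst

lemma exists_ae_monotoneOn_invF_comp_cdf (h : ∀ s : ℝ, P {s} = 0) :
    ∃ G ∈ ae P, MonotoneOn (fun s => invF Q ((P (Set.Iic s)).toReal)) G := by
  have hae := ae_cdf_mem_Ioo P h
  simp only [ProbabilityTheory.cdf_eq_real] at hae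
  exact ⟨_, hae, fun s hs t ht hst => invF_monotoneOn Q hs ht
    (measureReal_mono (Set.Iic_subset_Iic.2 hst))⟩

end Rearrangement

section Cost

lemma lintegral_ofReal_sub_sq {Ω : Type*} [MeasurableSpace Ω] (μ : Measure Ω) [SFinite μ]
    {X Y : Ω → ℝ} (hX : Measurable X) (hY : Measurable Y) :
    ∫⁻ ω, ENNReal.ofReal (Y ω - X ω) ^ 2 ∂μ =
      ∫⁻ z : ℝ × ℝ, μ {ω | X ω ≤ z.1 ⊓ z.2 ∧ z.1 ⊔ z.2 < Y ω} := by
  let S : Set (Ω × (ℝ × ℝ)) := {q | X q.1 ≤ q.2.1 ⊓ q.2.2} ∩ {q | q.2.1 ⊔ q.2.2 < Y q.1}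
  have hS : MeasurableSet S :=
    (measurableSet_le (by fun_prop) (by fun_prop)).inter
      (measurableSet_lt (by fun_prop) (by fun_prop))
  have h1 := Measure.prod_apply (μ := μ) (ν := (volume : Measure (ℝ × ℝ))) hS
  rw [Measure.prod_apply_symm hS] at h1
  refine Eq.trans ?_ h1.symm
  refine lintegral_congr fun ω => ?_
  have : Prod.mk ω ⁻¹' S = Set.Ico (X ω) (Y ω) ×ˢ Set.Ico (X ω) (Y ω) := by
    ext z
    simp only [S, Set.mem_preimage, Set.mem_inter_iff, Set.mem_ofPred_eq, le_inf_iff, sup_lt_iff, Set.mem_prod,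
      Set.mem_Ico]
    tauto
  rw [this, Measure.volume_eq_prod, Measure.prod_prod, Real.volume_Ico, sq]

lemma ofReal_sub_sq (x y : ℝ) :
    ENNReal.ofReal ((x - y) ^ 2) = ENNReal.ofReal (y - x) ^ 2 + ENNReal.ofReal (x - y) ^ 2 := by
  rcases le_total x y with h | h
  · rw [ENNReal.ofReal_of_nonpos (sub_nonpos.2 h), ← neg_sub y x, neg_sq,
      ENNReal.ofReal_pow (sub_nonneg.2 h)]
    simp
  · rw [ENNReal.ofReal_of_nonpos (sub_nonpos.2 h), ENNReal.ofReal_pow (sub_nonneg.2 h)]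
    simp

lemma lintegral_sub_sq_eq_layerCake {Ω : Type*} [MeasurableSpace Ω] (μ : Measure Ω) [SFinite μ]
    {X Y : Ω → ℝ} (hX : Measurable X) (hY : Measurable Y) :
    ∫⁻ ω, ENNReal.ofReal ((X ω - Y ω) ^ 2) ∂μ =
      (∫⁻ z : ℝ × ℝ, μ ({ω | X ω ≤ z.1 ⊓ z.2} \ {ω | Y ω ≤ z.1 ⊔ z.2})) +
        ∫⁻ z : ℝ × ℝ, μ ({ω | Y ω ≤ z.1 ⊓ z.2} \ {ω | X ω ≤ z.1 ⊔ z.2}) := by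
  have hdiff (X Y : Ω → ℝ) (a b : ℝ) :
      {ω | X ω ≤ a} \ {ω | Y ω ≤ b} = {ω | X ω ≤ a ∧ b < Y ω} := by
    ext ω; simp
  simp_rw [ofReal_sub_sq, hdiff]
  rw [lintegral_add_left (by fun_prop), lintegral_ofReal_sub_sq μ hX hY,
    lintegral_ofReal_sub_sq μ hY hX]

lemma measure_diff_le_sub_of_ae_le_or {Ω : Type*} [MeasurableSpace Ω] (μ : Measure Ω)
    [IsFiniteMeasure μ] {A B : Set Ω} (hB : MeasurableSet B) (h : A ≤ᵐ[μ] B ∨ B ≤ᵐ[μ] A) :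
    μ (A \ B) ≤ μ A - μ B := by
  rcases h with h | h
  · rw [ae_le_set.1 h]
    exact zero_le
  · have hAB : μ (A ∩ B) = μ B := measure_congr (by
      filter_upwards [h] with ω hω
      exact propext ⟨fun h => h.2, fun h => ⟨hω h, h⟩⟩)
    rw [← hAB, ← measure_inter_add_sdiff A hB, ENNReal.add_sub_cancel_left (measure_ne_top _ _)]

lemma ae_le_or_ae_le_of_monotoneOn {μ : Measure ℝ} {T : ℝ → ℝ} {G : Set ℝ} (hG : G ∈ ae μ)
    (hT : MonotoneOn T G) (a b : ℝ) :
    {s | s ≤ a} ≤ᵐ[μ] {s | T s ≤ b} ∨ {s | T s ≤ b} ≤ᵐ[μ] {s | s ≤ a} := by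
  by_cases h : ∀ s ∈ G, s ≤ a → T s ≤ b
  · left
    filter_upwards [hG] with s hs using h s hs
  · right
    push Not at h
    obtain ⟨s, hs, hsa, hsb⟩ := h
    filter_upwards [hG] with r hr (hrb : T r ≤ b)
    by_contra hra
    exact absurd (hT hs hr (hsa.trans (not_le.1 hra).le)) (by linarith)

/-- Monotone maps minimise the quadratic transport cost. -/
lemma lintegral_sub_sq_le_of_monotoneOn {P Q : Measure ℝ} [IsFiniteMeasure P] {T : ℝ → ℝ}
    (hT : Measurable T) (hmap : P.map T = Q) {G : Set ℝ} (hG : G ∈ ae P) (hmono : MonotoneOn T G)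
    {π : Measure (ℝ × ℝ)} [SFinite π] (hπ : IsCoupling P Q π) :
    ∫⁻ s, ENNReal.ofReal ((s - T s) ^ 2) ∂P ≤ ∫⁻ p, ENNReal.ofReal ((p.1 - p.2) ^ 2) ∂π := by
  have hP1 (a : ℝ) : P {s | s ≤ a} = π {p | p.1 ≤ a} := by
    have h1 := Measure.map_apply (μ := π) measurable_fst (measurableSet_Iic (a := a))
    rw [hπ.1] at h1
    exact h1
  have hQ1 (a : ℝ) : P {s | T s ≤ a} = π {p | p.2 ≤ a} := by
    have h1 := Measure.map_apply (μ := P) hT (measurableSet_Iic (a := a))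
    rw [hmap, ← hπ.2, Measure.map_apply measurable_snd measurableSet_Iic] at h1
    exact h1.symm
  rw [lintegral_sub_sq_eq_layerCake P (X := fun s => s) measurable_id hT,
    lintegral_sub_sq_eq_layerCake π measurable_fst measurable_snd]
  refine add_le_add (lintegral_mono fun z => ?_) (lintegral_mono fun z => ?_)
  · refine (measure_diff_le_sub_of_ae_le_or P (hT measurableSet_Iic)
      (ae_le_or_ae_le_of_monotoneOn hG hmono _ _)).trans ?_
    exact (tsub_le_tsub (hP1 _).le (hQ1 _).ge).trans le_measure_sdiff
  · refine (measure_diff_le_sub_of_ae_le_or P measurableSet_Iic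
      (ae_le_or_ae_le_of_monotoneOn hG hmono _ _).symm).trans ?_
    exact (tsub_le_tsub (hQ1 _).le (hP1 _).ge).trans le_measure_sdiff

end Cost

/-- The monotone rearrangement `T = F_Q⁻¹ ∘ F_P` solves the one-dimensional Monge problem
with quadratic cost, provided the source measure `P` is atomless. -/
theorem monotone_rearrangement_is_optimal (P Q : Measure ℝ)
    [IsProbabilityMeasure P] [IsProbabilityMeasure Q]
    (hP : Integrable (fun s => s ^ 2) P) (hQ : Integrable (fun s => s ^ 2) Q)
    (hatomless : ∀ s : ℝ, P {s} = 0) :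
    Measurable (fun s => invF Q ((P (Set.Iic s)).toReal)) ∧
    P.map (fun s => invF Q ((P (Set.Iic s)).toReal)) = Q ∧
    (∫⁻ s, ENNReal.ofReal ((s - invF Q ((P (Set.Iic s)).toReal)) ^ 2) ∂P) =
      ⨅ (π : Measure (ℝ × ℝ)) (_ : IsCoupling P Q π),
        ∫⁻ p, ENNReal.ofReal ((p.1 - p.2) ^ 2) ∂π := by
  have hT := measurable_invF_comp_cdf P Q
  have hmap := map_invF_comp_cdf P Q hatomless
  obtain ⟨G, hG, hmono⟩ := exists_ae_monotoneOn_invF_comp_cdf P Q hatomless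
  refine ⟨hT, hmap, le_antisymm (le_iInf₂ fun π hπ => ?_) ?_⟩
  · have : IsProbabilityMeasure (π.map Prod.fst) := by rw [hπ.1]; infer_instance
    have : IsProbabilityMeasure π := Measure.isProbabilityMeasure_of_map Prod.fst
    exact lintegral_sub_sq_le_of_monotoneOn hT hmap hG hmono hπ
  · have hgraph : Measurable fun s => (s, invF Q ((P (Set.Iic s)).toReal)) :=
      measurable_id.prodMk hT
    have hcoupling : IsCoupling P Q (P.map fun s => (s, invF Q ((P (Set.Iic s)).toReal))) := by
      constructor
      · rw [Measure.map_map measurable_fst hgraph]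
        exact Measure.map_id
      · rw [Measure.map_map measurable_snd hgraph]
        exact hmap
    refine (iInf₂_le _ hcoupling).trans_eq ?_
    rw [lintegral_map (by fun_prop) hgraph]
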